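/- Let (X, b, s) be a complete b-metric space with coefficient s ≥ 1 and let S : X → X be b-continuous (i.e. whenever a_n → a with respect to b, also S a_n → S a). Suppose there exist an A_R-simulation function J : [1,∞) × [1,∞) → ℝ whose sequence condition holds with the same coefficient s (with associated function F ∈ 𝔉_c having constant c ≥ 1 and function ϑ ∈ Θ*) such that for all x, y ∈ X with Sx ≠ Sy, J(ϑ(b(Sx,Sy)), ϑ(max{b(x,y), b(x,Sx), b(y,Sy), (b(Sx,y) + b(x,Sy))/(2s)})) ≥ c. Then S has a unique fixed point in X. -/

import Mathlib

open Filter Topology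

/-- A b-metric on `X` with coefficient `s`. -/
def IsBMetric {X : Type*} (b : X → X → ℝ) (s : ℝ) : Prop :=
  (∀ x y, 0 ≤ b x y) ∧
  (∀ x y, b x y = 0 ↔ x = y) ∧
  (∀ x y, b x y = b y x) ∧
  (∀ x y z, b x z ≤ s * (b x y + b y z))

/-- A sequence is Cauchy with respect to a b-metric. -/
def BCauchy {X : Type*} (b : X → X → ℝ) (u : ℕ → X) : Prop :=
  ∀ ε > (0 : ℝ), ∃ N : ℕ, ∀ k ≥ N, ∀ m ≥ N, b (u k) (u m) < ε

/-- Completeness of a b-metric space: every Cauchy sequence converges. -/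
def BComplete {X : Type*} (b : X → X → ℝ) : Prop :=
  ∀ u : ℕ → X, BCauchy b u → ∃ z : X, Tendsto (fun n => b (u n) z) atTop (𝓝 0)

/-- `S` is b-continuous: it preserves convergence of sequences. -/
def BContinuousMap {X : Type*} (b : X → X → ℝ) (S : X → X) : Prop :=
  ∀ (u : ℕ → X) (x : X), Tendsto (fun n => b (u n) x) atTop (𝓝 0) →
    Tendsto (fun n => b (S (u n)) (S x)) atTop (𝓝 0)

/-- The class `Θ*` of auxiliary functions `ϑ : (0,∞) → (1,∞)`:
increasing, continuous, and `ϑ(aₙ) → 1` iff `aₙ → 0`. -/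
def ThetaStar (ϑ : ℝ → ℝ) : Prop :=
  (∀ x, 0 < x → 1 < ϑ x) ∧
  MonotoneOn ϑ (Set.Ioi 0) ∧
  ContinuousOn ϑ (Set.Ioi 0) ∧
  ∀ u : ℕ → ℝ, (∀ n, 0 < u n) →
    (Tendsto (fun n => ϑ (u n)) atTop (𝓝 1) ↔ Tendsto u atTop (𝓝 0))

/-- The class `𝔉_c` of functions `F : [1,∞) × [1,∞) → ℝ` with constant `c ≥ 1`. -/
def FcClass (F : ℝ → ℝ → ℝ) (c : ℝ) : Prop :=
  ContinuousOn (fun p : ℝ × ℝ => F p.1 p.2) (Set.Ici 1 ×ˢ Set.Ici 1) ∧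
  (∀ x y, 1 ≤ x → 1 ≤ y → F x y ≤ x) ∧
  (∀ x y, 1 ≤ x → 1 ≤ y → F x y = x → x = 1 ∨ y = 1) ∧
  1 ≤ c ∧
  (∀ x y, 1 ≤ x → 1 ≤ y → c < F x y → y < x) ∧
  (∀ x, 1 ≤ x → F x x ≤ c)

/-- The condition on a pair of positive sequences appearing in the definition of an
`A_R`-simulation function with coefficient `s`:
`0 < liminf uₙ ≤ s·limsup vₙ ≤ s²·liminf uₙ < ∞` and
`0 < liminf vₙ ≤ s·limsup uₙ ≤ s²·liminf vₙ < ∞` (computed in the extended reals). -/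
def SeqCond (s : ℝ) (u v : ℕ → ℝ) : Prop :=
  (0 < Filter.liminf (fun n => ((u n : EReal))) atTop ∧
    Filter.liminf (fun n => ((u n : EReal))) atTop ≤
      (s : EReal) * Filter.limsup (fun n => ((v n : EReal))) atTop ∧
    (s : EReal) * Filter.limsup (fun n => ((v n : EReal))) atTop ≤
      ((s ^ 2 : ℝ) : EReal) * Filter.liminf (fun n => ((u n : EReal))) atTop ∧
    ((s ^ 2 : ℝ) : EReal) * Filter.liminf (fun n => ((u n : EReal))) atTop < ⊤) ∧
  (0 < Filter.liminf (fun n => ((v n : EReal))) atTop ∧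
    Filter.liminf (fun n => ((v n : EReal))) atTop ≤
      (s : EReal) * Filter.limsup (fun n => ((u n : EReal))) atTop ∧
    (s : EReal) * Filter.limsup (fun n => ((u n : EReal))) atTop ≤
      ((s ^ 2 : ℝ) : EReal) * Filter.liminf (fun n => ((v n : EReal))) atTop ∧
    ((s ^ 2 : ℝ) : EReal) * Filter.liminf (fun n => ((v n : EReal))) atTop < ⊤)

/-- `J` is an `A_R`-simulation function with data `s`, `F ∈ 𝔉_c` (constant `c`), `ϑ ∈ Θ*`. -/
def ARSimulation (J : ℝ → ℝ → ℝ) (s : ℝ) (F : ℝ → ℝ → ℝ) (c : ℝ) (ϑ : ℝ → ℝ) : Prop :=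
  (∀ x y : ℝ, 1 < x → 1 < y → J x y < F y x) ∧
  ∀ u v : ℕ → ℝ, (∀ n, 0 < u n) → (∀ n, 0 < v n) → SeqCond s u v →
    Filter.limsup (fun n => J (ϑ (u n)) (ϑ (v n))) atTop < c

lemma EReal.liminf_limsup_coe_bounds {w : ℕ → ℝ} {l r : ℝ} (hl : ∀ n, l ≤ w n)
    (hr : ∀ L > r, ∀ᶠ n in atTop, w n ≤ L) :
    (l : EReal) ≤ liminf (fun n => (w n : EReal)) atTop ∧
    liminf (fun n => (w n : EReal)) atTop ≤ limsup (fun n => (w n : EReal)) atTop ∧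
    limsup (fun n => (w n : EReal)) atTop ≤ (r : EReal) := by
  refine ⟨?_, liminf_le_limsup, ?_⟩
  · exact le_liminf_of_le (by isBoundedDefault)
      (Eventually.of_forall fun n => EReal.coe_le_coe_iff.2 (hl n))
  · refine EReal.le_of_forall_lt_iff_le.1 fun L hL => ?_
    exact limsup_le_of_le (by isBoundedDefault)
      ((hr L (EReal.coe_lt_coe_iff.1 hL)).mono fun n hn => EReal.coe_le_coe_iff.2 hn)

lemma seqCond_of_bounds {s ε : ℝ} (hs : 1 ≤ s) (hε : 0 < ε) {u v : ℕ → ℝ}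
    (hu : ∀ n, ε ≤ u n) (hv : ∀ n, ε ≤ v n)
    (hu' : ∀ L > s * ε, ∀ᶠ n in atTop, u n ≤ L)
    (hv' : ∀ L > s * ε, ∀ᶠ n in atTop, v n ≤ L) : SeqCond s u v := by
  obtain ⟨hu1, hu2, hu3⟩ := EReal.liminf_limsup_coe_bounds hu hu'
  obtain ⟨hv1, hv2, hv3⟩ := EReal.liminf_limsup_coe_bounds hv hv'
  unfold SeqCond
  generalize liminf (fun n => (u n : EReal)) atTop = A at *
  generalize limsup (fun n => (u n : EReal)) atTop = B at *
  generalize liminf (fun n => (v n : EReal)) atTop = C at *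
  generalize limsup (fun n => (v n : EReal)) atTop = D at *
  have real_of_bounds : ∀ E : EReal, (ε : EReal) ≤ E → E ≤ ((s * ε : ℝ) : EReal) →
      E ≠ ⊤ ∧ E ≠ ⊥ := fun E h1 h2 =>
    ⟨(h2.trans_lt (EReal.coe_lt_top _)).ne, ((EReal.bot_lt_coe _).trans_le h1).ne'⟩
  lift A to ℝ using real_of_bounds A hu1 (hu2.trans hu3)
  lift B to ℝ using real_of_bounds B (hu1.trans hu2) hu3
  lift C to ℝ using real_of_bounds C hv1 (hv2.trans hv3)
  lift D to ℝ using real_of_bounds D (hv1.trans hv2) hv3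
  simp only [← EReal.coe_mul, EReal.coe_le_coe_iff, ← EReal.coe_zero, EReal.coe_lt_coe_iff,
    EReal.coe_lt_top, and_true] at *
  refine ⟨⟨by linarith, by nlinarith, ?_⟩, by linarith, by nlinarith, ?_⟩
  · nlinarith [mul_le_mul_of_nonneg_left hv3 (by linarith : 0 ≤ s),
      mul_le_mul_of_nonneg_left hu1 (sq_nonneg s)]
  · nlinarith [mul_le_mul_of_nonneg_left hu3 (by linarith : 0 ≤ s),
      mul_le_mul_of_nonneg_left hv1 (sq_nonneg s)]

lemma ARSimulation.lt_of_le {J F : ℝ → ℝ → ℝ} {s c : ℝ} {ϑ : ℝ → ℝ} (hJ : ARSimulation J s F c ϑ)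
    (hϑ : ThetaStar ϑ) (hF : FcClass F c) {a d : ℝ} (ha : 0 < a) (hd : 0 < d)
    (h : c ≤ J (ϑ a) (ϑ d)) : a < d := by
  have h1 := hϑ.1 a ha
  have h2 := hϑ.1 d hd
  have h3 := hF.2.2.2.2.1 _ _ h2.le h1.le (h.trans_lt (hJ.1 _ _ h1 h2))
  by_contra! hda
  exact absurd (hϑ.2.1 hd ha hda) h3.not_ge

lemma ARSimulation.false_of_bounds {J F : ℝ → ℝ → ℝ} {s c : ℝ} {ϑ : ℝ → ℝ}
    (hJ : ARSimulation J s F c ϑ) (hϑ : ThetaStar ϑ) (hF : FcClass F c) (hs : 1 ≤ s)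
    {ε : ℝ} (hε : 0 < ε) {u v : ℕ → ℝ} (hu : ∀ n, ε ≤ u n) (hv : ∀ n, 0 < v n)
    (hv' : ∀ L > s * ε, ∀ᶠ n in atTop, v n ≤ L)
    (h : ∀ n, c ≤ J (ϑ (u n)) (ϑ (v n))) : False := by
  have hupos : ∀ n, 0 < u n := fun n => hε.trans_le (hu n)
  have huv : ∀ n, u n < v n := fun n => hJ.lt_of_le hϑ hF (hupos n) (hv n) (h n)
  have hlim := hJ.2 u v hupos hv (seqCond_of_bounds hs hε hu (fun n => (hu n).trans (huv n).le)
    (fun L hL => (hv' L hL).mono fun n hn => (huv n).le.trans hn) hv')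
  refine absurd hlim (not_lt.2 ?_)
  refine le_limsup_of_frequently_le (Frequently.of_forall h) ?_
  have hL : 0 < s * ε + 1 := by positivity
  refine ⟨ϑ (s * ε + 1), eventually_map.2 ((hv' (s * ε + 1) (by linarith)).mono fun n hn => ?_)⟩
  exact ((hJ.1 _ _ (hϑ.1 _ (hupos n)) (hϑ.1 _ (hv n))).le.trans
    (hF.2.1 _ _ (hϑ.1 _ (hv n)).le (hϑ.1 _ (hupos n)).le)).trans (hϑ.2.1 (hv n) hL hn)

lemma exists_crossing_of_not_bCauchy {X : Type*} {b : X → X → ℝ} {s : ℝ} (hb : IsBMetric b s)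
    {x : ℕ → X} (h : ¬ BCauchy b x) :
    ∃ ε > 0, ∀ N : ℕ, ∃ m ≥ N, ∃ n ≥ N, ε ≤ b (x (m + 1)) (x (n + 1)) ∧
      b (x m) (x (n + 1)) < ε := by
  obtain ⟨-, hb0, hbs, -⟩ := hb
  unfold BCauchy at h
  push Not at h
  obtain ⟨ε, hε, h⟩ := h
  refine ⟨ε, hε, fun N => ?_⟩
  have hex : ∃ k ≥ N + 1, ∃ m ≥ k, ε ≤ b (x m) (x k) := by
    obtain ⟨k, hk, m, hm, hkm⟩ := h (N + 1)
    rcases le_total k m with hle | hle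
    · exact ⟨k, hk, m, hle, by rwa [hbs]⟩
    · exact ⟨m, hm, k, hle, hkm⟩
  obtain ⟨k, hk, hex⟩ := hex
  classical
  obtain ⟨hm, hmk⟩ := Nat.find_spec hex
  have hmin := fun j => Nat.find_min hex (m := j)
  generalize Nat.find hex = m at *
  have hne : m ≠ k := by
    rintro rfl
    rw [(hb0 _ _).2 rfl] at hmk
    linarith
  obtain ⟨m, rfl⟩ : ∃ j, m = j + 1 := ⟨m - 1, by omega⟩
  obtain ⟨n, rfl⟩ : ∃ j, k = j + 1 := ⟨k - 1, by omega⟩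
  refine ⟨m, by omega, n, by omega, hmk, ?_⟩
  by_contra! hcon
  exact hmin m (Nat.lt_succ_self m) ⟨by omega, hcon⟩

/-- The right-hand side of the generalized contraction condition. -/
noncomputable def bContractionMax {X : Type*} (b : X → X → ℝ) (s : ℝ) (S : X → X) (x y : X) : ℝ :=
  max (max (b x y) (b x (S x))) (max (b y (S y)) ((b (S x) y + b x (S y)) / (2 * s)))

lemma bContractionMax_step_le {X : Type*} {b : X → X → ℝ} {s : ℝ} (hs : 1 ≤ s)
    (hb : IsBMetric b s) (S : X → X) (x : X) :
    bContractionMax b s S x (S x) ≤ max (b x (S x)) (b (S x) (S (S x))) := by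
  obtain ⟨-, hb0, -, hbt⟩ := hb
  unfold bContractionMax
  refine max_le (max_le (le_max_left _ _) (le_max_left _ _)) (max_le (le_max_right _ _) ?_)
  rw [(hb0 (S x) (S x)).2 rfl, div_le_iff₀ (by linarith), zero_add]
  have h1 := le_max_left (b x (S x)) (b (S x) (S (S x)))
  have h2 := le_max_right (b x (S x)) (b (S x) (S (S x)))
  nlinarith [hbt x (S x) (S (S x))]

lemma bContractionMax_le_of_crossing {X : Type*} {b : X → X → ℝ} {s : ℝ} (hs : 1 ≤ s)
    (hb : IsBMetric b s) (S : X → X) {x y : X} {ε η : ℝ} (hε : 0 < ε)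
    (hx : b x (S x) ≤ η) (hy : b y (S y) ≤ η) (hxy : b x (S y) < ε) :
    bContractionMax b s S x y ≤ s * ε + s * η := by
  obtain ⟨hbn, -, hbs, hbt⟩ := hb
  have hη : 0 ≤ η := (hbn _ _).trans hx
  have hsη : η ≤ s * η := le_mul_of_one_le_left hη hs
  have hsε : ε ≤ s * ε := le_mul_of_one_le_left hε.le hs
  have h1 : b x y ≤ s * ε + s * η := by
    have := hbt x (S y) y
    rw [hbs (S y) y] at this
    nlinarith
  have h2 : b (S x) y ≤ s * (η + (s * ε + s * η)) := by
    have := hbt (S x) x y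
    rw [hbs (S x) x] at this
    exact this.trans (mul_le_mul_of_nonneg_left (by linarith) (by linarith))
  unfold bContractionMax
  refine max_le (max_le h1 (by linarith)) (max_le (by linarith) ?_)
  rw [div_le_iff₀ (by linarith)]
  nlinarith [mul_le_mul_of_nonneg_left hsη (by linarith : 0 ≤ s),
    mul_le_mul_of_nonneg_left hsε (by linarith : 0 ≤ s)]

lemma IsBMetric.pos {X : Type*} {b : X → X → ℝ} {s : ℝ} (hb : IsBMetric b s) {x y : X}
    (h : x ≠ y) : 0 < b x y :=
  (hb.1 x y).lt_of_ne fun h0 => h ((hb.2.1 x y).1 h0.symm)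

lemma IsBMetric.eq_of_tendsto {X : Type*} {b : X → X → ℝ} {s : ℝ} (hb : IsBMetric b s)
    {x : ℕ → X} {y z : X} (hy : Tendsto (fun n => b (x n) y) atTop (𝓝 0))
    (hz : Tendsto (fun n => b (x n) z) atTop (𝓝 0)) : y = z := by
  obtain ⟨hbn, hb0, hbs, hbt⟩ := hb
  refine (hb0 y z).1 (le_antisymm ?_ (hbn y z))
  have hlim : Tendsto (fun n => s * (b (x n) y + b (x n) z)) atTop (𝓝 0) := by
    simpa using (hy.add hz).const_mul s
  refine ge_of_tendsto' hlim fun n => ?_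
  have := hbt y (x n) z
  rwa [hbs y (x n)] at this

section Contraction

variable {X : Type*} {b : X → X → ℝ} {s c : ℝ} {S : X → X} {J F : ℝ → ℝ → ℝ} {ϑ : ℝ → ℝ}

lemma tendsto_step_of_contraction (hs : 1 ≤ s) (hb : IsBMetric b s) (hϑ : ThetaStar ϑ)
    (hF : FcClass F c) (hJ : ARSimulation J s F c ϑ)
    (hcontr : ∀ x y : X, S x ≠ S y → c ≤ J (ϑ (b (S x) (S y))) (ϑ (bContractionMax b s S x y)))
    {x : ℕ → X} (hx : ∀ n, x (n + 1) = S (x n)) (hne : ∀ n, S (x n) ≠ x n) :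
    Tendsto (fun n => b (x n) (x (n + 1))) atTop (𝓝 0) := by
  have hdpos : ∀ n, 0 < b (x n) (x (n + 1)) := fun n => hb.pos (by rw [hx]; exact (hne n).symm)
  have hcon : ∀ n, c ≤ J (ϑ (b (x (n + 1)) (x (n + 2))))
      (ϑ (bContractionMax b s S (x n) (x (n + 1)))) := fun n => by
    have := hcontr (x n) (x (n + 1)) (by rw [← hx n]; exact (hne (n + 1)).symm)
    rwa [← hx n, ← hx (n + 1)] at this
  have hle : ∀ n, b (x n) (x (n + 1)) ≤ bContractionMax b s S (x n) (x (n + 1)) := fun n =>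
    (le_max_left _ _).trans (le_max_left _ _)
  have hge : ∀ n, bContractionMax b s S (x n) (x (n + 1)) ≤
      max (b (x n) (x (n + 1))) (b (x (n + 1)) (x (n + 2))) := fun n => by
    have := bContractionMax_step_le hs hb S (x n)
    rwa [← hx n, ← hx (n + 1)] at this
  have hlt : ∀ n, b (x (n + 1)) (x (n + 2)) < b (x n) (x (n + 1)) := fun n => by
    have := (hJ.lt_of_le hϑ hF (hdpos (n + 1)) ((hdpos n).trans_le (hle n)) (hcon n)).trans_le
      (hge n)
    exact (lt_max_iff.1 this).resolve_right (lt_irrefl _)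
  have heq : ∀ n, bContractionMax b s S (x n) (x (n + 1)) = b (x n) (x (n + 1)) := fun n =>
    le_antisymm ((hge n).trans (max_le le_rfl (hlt n).le)) (hle n)
  have hanti : Antitone fun n => b (x n) (x (n + 1)) :=
    antitone_nat_of_succ_le fun n => (hlt n).le
  have hbdd : BddBelow (Set.range fun n => b (x n) (x (n + 1))) :=
    ⟨0, by rintro _ ⟨n, rfl⟩; exact (hdpos n).le⟩
  have hlim := tendsto_atTop_ciInf hanti hbdd
  have hr0 : 0 ≤ ⨅ n, b (x n) (x (n + 1)) := le_ciInf fun n => (hdpos n).le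
  rcases hr0.eq_or_lt with hr | hr
  · rwa [← hr] at hlim
  · refine (hJ.false_of_bounds hϑ hF hs hr (u := fun n => b (x (n + 1)) (x (n + 2)))
      (v := fun n => b (x n) (x (n + 1))) (fun n => ciInf_le hbdd (n + 1)) hdpos
      (fun L hL => ?_) (fun n => heq n ▸ hcon n)).elim
    exact hlim.eventually_le_const ((le_mul_of_one_le_left hr0 hs).trans_lt hL)

lemma bCauchy_of_contraction (hs : 1 ≤ s) (hb : IsBMetric b s) (hϑ : ThetaStar ϑ)
    (hF : FcClass F c) (hJ : ARSimulation J s F c ϑ)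
    (hcontr : ∀ x y : X, S x ≠ S y → c ≤ J (ϑ (b (S x) (S y))) (ϑ (bContractionMax b s S x y)))
    {x : ℕ → X} (hx : ∀ n, x (n + 1) = S (x n))
    (hd : Tendsto (fun n => b (x n) (x (n + 1))) atTop (𝓝 0)) : BCauchy b x := by
  by_contra hnot
  obtain ⟨ε, hε, h⟩ := exists_crossing_of_not_bCauchy hb hnot
  choose m hm n hn hge hlt using h
  have hS : ∀ k, S (x (m k)) ≠ S (x (n k)) := fun k heq => by
    have := hge k
    rw [hx, hx, heq, (hb.2.1 _ _).2 rfl] at this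
    linarith
  refine hJ.false_of_bounds hϑ hF hs hε (u := fun k => b (S (x (m k))) (S (x (n k))))
    (v := fun k => bContractionMax b s S (x (m k)) (x (n k))) (fun k => ?_) (fun k => ?_)
    (fun L hL => ?_) (fun k => hcontr _ _ (hS k))
  · simpa only [hx] using hge k
  · exact (hb.pos fun h => hS k (congrArg S h)).trans_le
      ((le_max_left _ _).trans (le_max_left _ _))
  · have hs0 : 0 < s := by linarith
    obtain ⟨N, hN⟩ := eventually_atTop.1
      (hd.eventually_le_const (div_pos (sub_pos.2 hL) hs0))
    filter_upwards [eventually_ge_atTop N] with k hk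
    have h1 := hN (m k) (hk.trans (hm k))
    have h2 := hN (n k) (hk.trans (hn k))
    have h3 := hlt k
    rw [hx] at h1 h2 h3
    have := bContractionMax_le_of_crossing hs hb S hε h1 h2 h3
    rw [mul_div_cancel₀ _ hs0.ne'] at this
    linarith

lemma eq_of_isFixedPt_of_contraction (hs : 1 ≤ s) (hb : IsBMetric b s) (hϑ : ThetaStar ϑ)
    (hF : FcClass F c) (hJ : ARSimulation J s F c ϑ)
    (hcontr : ∀ x y : X, S x ≠ S y → c ≤ J (ϑ (b (S x) (S y))) (ϑ (bContractionMax b s S x y)))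
    {y z : X} (hy : S y = y) (hz : S z = z) : y = z := by
  by_contra hne
  have hpos := hb.pos hne
  have heq : bContractionMax b s S y z = b y z := by
    unfold bContractionMax
    have h1 : (b y z + b y z) / (2 * s) ≤ b y z := by
      rw [div_le_iff₀ (by linarith)]
      nlinarith
    rw [hy, hz, (hb.2.1 y y).2 rfl, (hb.2.1 z z).2 rfl, max_eq_left hpos.le]
    exact max_eq_left (max_le hpos.le h1)
  have h := hcontr y z (by rwa [hy, hz])
  rw [heq, hy, hz] at h
  exact (hJ.lt_of_le hϑ hF hpos hpos h).false

end Contraction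

/-- A b-continuous generalized `𝔍_{A_R}`-contraction on a complete b-metric space
has a unique fixed point. -/
theorem fixed_point_of_generalized_JAR_contraction {X : Type*} [Nonempty X]
    (b : X → X → ℝ) (s : ℝ) (hs : 1 ≤ s)
    (hb : IsBMetric b s) (hcomp : BComplete b) (S : X → X)
    (hScont : BContinuousMap b S)
    (J F : ℝ → ℝ → ℝ) (ϑ : ℝ → ℝ) (c : ℝ)
    (hϑ : ThetaStar ϑ) (hF : FcClass F c)
    (hJ : ARSimulation J s F c ϑ)
    (hcontr : ∀ x y : X, S x ≠ S y →
      c ≤ J (ϑ (b (S x) (S y)))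
            (ϑ (max (max (b x y) (b x (S x)))
                (max (b y (S y)) ((b (S x) y + b x (S y)) / (2 * s)))))) :
    ∃! z : X, S z = z := by
  have huniq : ∀ y z : X, S y = y → S z = z → y = z := fun y z =>
    eq_of_isFixedPt_of_contraction hs hb hϑ hF hJ hcontr
  suffices hex : ∃ z, S z = z by
    obtain ⟨z, hz⟩ := hex
    exact ⟨z, hz, fun y hy => huniq y z hy hz⟩
  by_contra! hne
  obtain ⟨x₀⟩ := ‹Nonempty X›
  have hx : ∀ n, S^[n + 1] x₀ = S (S^[n] x₀) := fun n => Function.iterate_succ_apply' S n x₀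
  have hd := tendsto_step_of_contraction hs hb hϑ hF hJ hcontr
    (x := fun n => S^[n] x₀) hx fun n => hne _
  obtain ⟨z, hz⟩ := hcomp _ (bCauchy_of_contraction hs hb hϑ hF hJ hcontr (x := fun n => S^[n] x₀) hx hd)
  have hSz := hScont _ z hz
  simp only [← hx] at hSz
  exact hne z (hb.eq_of_tendsto hSz ((tendsto_add_atTop_iff_nat 1).2 hz))
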